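/- Let G be a finite simple graph with mad(G) < 18/7 and ch_3^d(G) > 6 such that every proper subgraph H of G (obtained from G by deleting at least one vertex or at least one edge) satisfies ch_3^d(H) ≤ 6. Then no two vertices of W_2(G) are adjacent. -/

import Mathlib

open SimpleGraph

/-- `φ` is a proper coloring of `G` that is 3-dynamic: every vertex `v` sees at least
`min 3 (deg v)` distinct colors on its neighborhood. -/
def IsDyn3Coloring {V : Type*} (G : SimpleGraph V) (φ : V → ℕ) : Prop :=
  (∀ u v, G.Adj u v → φ u ≠ φ v) ∧
  ∀ v, min 3 (G.neighborSet v).ncard ≤ (φ '' G.neighborSet v).ncard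

/-- `G` is 3-dynamically colorable from the list assignment `L`. -/
def Dyn3ListColorable {V : Type*} (G : SimpleGraph V) (L : V → Finset ℕ) : Prop :=
  ∃ φ : V → ℕ, IsDyn3Coloring G φ ∧ ∀ v, φ v ∈ L v

/-- `ch_3^d(G) ≤ k` : `G` is 3-dynamically `L`-colorable for every list assignment `L`
with `|L v| ≥ k` for all `v`. -/
def Ch3dLE {V : Type*} (G : SimpleGraph V) (k : ℕ) : Prop :=
  ∀ L : V → Finset ℕ, (∀ v, k ≤ (L v).card) → Dyn3ListColorable G L

/-- `mad(G) < c` : every nonempty subgraph has average degree `< c`. -/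
def MadLT {V : Type*} (G : SimpleGraph V) (c : ℚ) : Prop :=
  ∀ H : G.Subgraph, H.verts.Nonempty →
    (2 * H.edgeSet.ncard : ℚ) / (H.verts.ncard : ℚ) < c

/-- `mad(G) ≤ c` : every nonempty subgraph has average degree `≤ c`. -/
def MadLE {V : Type*} (G : SimpleGraph V) (c : ℚ) : Prop :=
  ∀ H : G.Subgraph, H.verts.Nonempty →
    (2 * H.edgeSet.ncard : ℚ) / (H.verts.ncard : ℚ) ≤ c

/-- Every proper subgraph of `G` (deleting at least one vertex or edge) has
`ch_3^d ≤ k`. -/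
def ProperSubgraphsCh3dLE {V : Type*} (G : SimpleGraph V) (k : ℕ) : Prop :=
  ∀ H : G.Subgraph, H ≠ ⊤ → Ch3dLE H.coe k

/-- `x ∈ W_i(G)` : `x` has degree 3 and exactly `i` neighbors of degree 2. -/
def Wmem {V : Type*} (G : SimpleGraph V) (i : ℕ) (x : V) : Prop :=
  (G.neighborSet x).ncard = 3 ∧
    {y | G.Adj x y ∧ (G.neighborSet y).ncard = 2}.ncard = i

/-- `y` is a weak neighbor of `x` : they are distinct and have a common neighbor of
degree 2. -/
def WeakAdj {V : Type*} (G : SimpleGraph V) (x y : V) : Prop :=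
  x ≠ y ∧ ∃ w, G.Adj x w ∧ G.Adj y w ∧ (G.neighborSet w).ncard = 2


lemma aux_pick (A : Finset ℕ) (l : Finset ℕ) (h : l.card < A.card) : ∃ a ∈ A, a ∉ l := by
  by_contra hc
  push Not at hc
  exact absurd (Finset.card_le_card hc) (by omega)

lemma aux_pick1 (A : Finset ℕ) (h : 2 ≤ A.card) (p : ℕ) : ∃ a ∈ A, a ≠ p := by
  obtain ⟨a, h1, h2⟩ := aux_pick A {p} (by simp; omega)
  exact ⟨a, h1, by simpa using h2⟩

lemma aux_pick2 (A : Finset ℕ) (h : 3 ≤ A.card) (p q : ℕ) : ∃ a ∈ A, a ≠ p ∧ a ≠ q := by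
  obtain ⟨a, h1, h2⟩ := aux_pick A {p, q} (lt_of_le_of_lt Finset.card_le_two (by omega))
  exact ⟨a, h1, by simpa using h2⟩

lemma aux_pick3 (A : Finset ℕ) (h : 4 ≤ A.card) (p q r : ℕ) :
    ∃ a ∈ A, a ≠ p ∧ a ≠ q ∧ a ≠ r := by
  obtain ⟨a, h1, h2⟩ := aux_pick A {p, q, r} (lt_of_le_of_lt Finset.card_le_three (by omega))
  exact ⟨a, h1, by simpa using h2⟩

lemma aux_pick4 (A : Finset ℕ) (h : 5 ≤ A.card) (p q r t : ℕ) :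
    ∃ a ∈ A, a ≠ p ∧ a ≠ q ∧ a ≠ r ∧ a ≠ t := by
  obtain ⟨a, h1, h2⟩ := aux_pick A {p, q, r, t} (lt_of_le_of_lt Finset.card_le_four (by omega))
  exact ⟨a, h1, by simpa using h2⟩

/-- The colours solve the list problem on two `K4` sharing an edge. -/
def AuxSol (X Y A1 A2 B1 B2 : Finset ℕ) (r11 r12 r21 r22 : Prop) : Prop :=
  ∃ x ∈ X, ∃ y ∈ Y, ∃ a1 ∈ A1, ∃ a2 ∈ A2, ∃ b1 ∈ B1, ∃ b2 ∈ B2,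
    x ≠ y ∧ (a1 ≠ x ∧ a1 ≠ y) ∧ (a2 ≠ x ∧ a2 ≠ y) ∧ (b1 ≠ x ∧ b1 ≠ y) ∧ (b2 ≠ x ∧ b2 ≠ y) ∧
    a1 ≠ a2 ∧ b1 ≠ b2 ∧ (r11 → a1 ≠ b1) ∧ (r12 → a1 ≠ b2) ∧ (r21 → a2 ≠ b1) ∧ (r22 → a2 ≠ b2)

lemma AuxSol.swapA {X Y A1 A2 B1 B2 : Finset ℕ} {r11 r12 r21 r22 : Prop}
    (h : AuxSol X Y A2 A1 B1 B2 r21 r22 r11 r12) : AuxSol X Y A1 A2 B1 B2 r11 r12 r21 r22 := by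
  obtain ⟨x, hx, y, hy, a1, ha1, a2, ha2, b1, hb1, b2, hb2, h⟩ := h
  exact ⟨x, hx, y, hy, a2, ha2, a1, ha1, b1, hb1, b2, hb2, by grind⟩

lemma AuxSol.swapB {X Y A1 A2 B1 B2 : Finset ℕ} {r11 r12 r21 r22 : Prop}
    (h : AuxSol X Y A1 A2 B2 B1 r12 r11 r22 r21) : AuxSol X Y A1 A2 B1 B2 r11 r12 r21 r22 := by
  obtain ⟨x, hx, y, hy, a1, ha1, a2, ha2, b1, hb1, b2, hb2, h⟩ := h
  exact ⟨x, hx, y, hy, a1, ha1, a2, ha2, b2, hb2, b1, hb1, by grind⟩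

lemma AuxSol.swapXY {X Y A1 A2 B1 B2 : Finset ℕ} {r11 r12 r21 r22 : Prop}
    (h : AuxSol Y X B1 B2 A1 A2 r11 r21 r12 r22) : AuxSol X Y A1 A2 B1 B2 r11 r12 r21 r22 := by
  obtain ⟨x, hx, y, hy, a1, ha1, a2, ha2, b1, hb1, b2, hb2, h⟩ := h
  exact ⟨y, hy, x, hx, b1, hb1, b2, hb2, a1, ha1, a2, ha2, by grind⟩

lemma aux_two (A1 A2 A : Finset ℕ) (hA : A ⊆ A1) (hc : A.card = 3) (h2 : 3 ≤ A2.card) (x y : ℕ)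
    (h : x ∉ A ∨ y ∉ A) :
    ∃ a1 ∈ A1, ∃ a2 ∈ A2, (a1 ≠ x ∧ a1 ≠ y) ∧ (a2 ≠ x ∧ a2 ≠ y) ∧ a1 ≠ a2 := by
  obtain ⟨a2, h3, h4⟩ := aux_pick2 A2 h2 x y
  rcases h with h | h
  · obtain ⟨a, h5, h6⟩ := aux_pick2 A hc.ge y a2
    exact ⟨a, hA h5, a2, h3, by grind⟩
  · obtain ⟨a, h5, h6⟩ := aux_pick2 A hc.ge x a2
    exact ⟨a, hA h5, a2, h3, by grind⟩

lemma aux_R0 (X Y A1 A2 B1 B2 : Finset ℕ) {r11 r12 r21 r22 : Prop}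
    (hX : 4 ≤ X.card) (hY : 4 ≤ Y.card) (h1 : 3 ≤ A1.card) (h2 : 3 ≤ A2.card)
    (h3 : 3 ≤ B1.card) (h4 : 3 ≤ B2.card) (n11 : ¬ r11) (n12 : ¬ r12) (n21 : ¬ r21)
    (n22 : ¬ r22) : AuxSol X Y A1 A2 B1 B2 r11 r12 r21 r22 := by
  obtain ⟨A, hA, hAc⟩ := Finset.exists_subset_card_eq h1
  obtain ⟨B, hB, hBc⟩ := Finset.exists_subset_card_eq h3
  obtain ⟨d, hd, hdA⟩ := aux_pick X A (by omega)
  obtain ⟨e, he, heB⟩ := aux_pick Y B (by omega)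
  have : ∃ x ∈ X, ∃ y ∈ Y, x ≠ y ∧ (x ∉ A ∨ y ∉ A) ∧ (x ∉ B ∨ y ∉ B) := by
    by_cases hde : d = e
    · obtain ⟨y, hy, hy2⟩ := aux_pick1 Y (by omega) d
      exact ⟨d, hd, y, hy, by grind⟩
    · exact ⟨d, hd, e, he, by grind⟩
  obtain ⟨x, hx, y, hy, hxy, hxA, hxB⟩ := this
  obtain ⟨a1, ha1, a2, ha2, h5⟩ := aux_two A1 A2 A hA hAc h2 x y hxA
  obtain ⟨b1, hb1, b2, hb2, h6⟩ := aux_two B1 B2 B hB hBc h4 x y hxB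
  exact ⟨x, hx, y, hy, a1, ha1, a2, ha2, b1, hb1, b2, hb2, by grind⟩

lemma aux_R1 (X Y A1 A2 B1 B2 : Finset ℕ) {r11 r12 r21 r22 : Prop}
    (hX : 4 ≤ X.card) (hY : 4 ≤ Y.card) (h1 : 4 ≤ A1.card) (h1' : r12 → 5 ≤ A1.card)
    (h2 : 3 ≤ A2.card)
    (h3 : 4 ≤ B1.card) (h4 : 3 ≤ B2.card) (n21 : ¬ r21)
    (n22 : ¬ r22) : AuxSol X Y A1 A2 B1 B2 r11 r12 r21 r22 := by
  obtain ⟨A, hA, hAc⟩ := Finset.exists_subset_card_eq h2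
  obtain ⟨x, hx, hxA⟩ := aux_pick X A (by omega)
  obtain ⟨b2, hb2, hb2'⟩ := aux_pick1 B2 (by omega) x
  obtain ⟨y, hy, hy'⟩ := aux_pick2 Y (by omega) x b2
  obtain ⟨b1, hb1, hb1'⟩ := aux_pick3 B1 (by omega) x y b2
  have : ∃ a ∈ A1, a ≠ x ∧ a ≠ y ∧ a ≠ b1 ∧ (r12 → a ≠ b2) := by
    by_cases hr : r12
    · obtain ⟨a, ha, ha'⟩ := aux_pick4 A1 (h1' hr) x y b1 b2
      exact ⟨a, ha, by grind⟩
    · obtain ⟨a, ha, ha'⟩ := aux_pick3 A1 h1 x y b1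
      exact ⟨a, ha, by grind⟩
  obtain ⟨a1, ha1, ha1'⟩ := this
  obtain ⟨a2, ha2, ha2'⟩ := aux_pick2 A hAc.ge y a1
  exact ⟨x, hx, y, hy, a1, ha1, a2, hA ha2, b1, hb1, b2, hb2, by grind⟩

lemma aux_C4' (P0 P1 P2 P3 : Finset ℕ) (h0 : 2 ≤ P0.card) (h1 : 2 ≤ P1.card) (h2 : 2 ≤ P2.card)
    (h3 : 2 ≤ P3.card) (c : ℕ) (hc : c ∈ P0) (hc' : c ∉ P1) :
    ∃ p0 ∈ P0, ∃ p1 ∈ P1, ∃ p2 ∈ P2, ∃ p3 ∈ P3, p0 ≠ p1 ∧ p1 ≠ p2 ∧ p2 ≠ p3 ∧ p3 ≠ p0 := by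
  obtain ⟨p3, hp3, h3'⟩ := aux_pick1 P3 h3 c
  obtain ⟨p2, hp2, h2'⟩ := aux_pick1 P2 h2 p3
  obtain ⟨p1, hp1, h1'⟩ := aux_pick1 P1 h1 p2
  exact ⟨c, hc, p1, hp1, p2, hp2, p3, hp3, by grind⟩

lemma aux_C4 (P0 P1 P2 P3 : Finset ℕ) (h0 : 2 ≤ P0.card) (h1 : 2 ≤ P1.card) (h2 : 2 ≤ P2.card)
    (h3 : 2 ≤ P3.card) :
    ∃ p0 ∈ P0, ∃ p1 ∈ P1, ∃ p2 ∈ P2, ∃ p3 ∈ P3, p0 ≠ p1 ∧ p1 ≠ p2 ∧ p2 ≠ p3 ∧ p3 ≠ p0 := by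
  by_cases e01 : P0 ⊆ P1
  · by_cases e12 : P1 ⊆ P2
    · by_cases e23 : P2 ⊆ P3
      · obtain ⟨c, hc⟩ := Finset.card_pos.1 (show 0 < P0.card by omega)
        obtain ⟨d, hd, hdc⟩ := aux_pick1 P0 h0 c
        exact ⟨c, hc, d, e01 hd, c, e12 (e01 hc), d, e23 (e12 (e01 hd)), by grind⟩
      · obtain ⟨c, hc, hc'⟩ := Finset.not_subset.1 e23
        obtain ⟨p2, m2, p3, m3, p0, m0, p1, m1, h⟩ := aux_C4' P2 P3 P0 P1 h2 h3 h0 h1 c hc hc'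
        exact ⟨p0, m0, p1, m1, p2, m2, p3, m3, by grind⟩
    · obtain ⟨c, hc, hc'⟩ := Finset.not_subset.1 e12
      obtain ⟨p1, m1, p2, m2, p3, m3, p0, m0, h⟩ := aux_C4' P1 P2 P3 P0 h1 h2 h3 h0 c hc hc'
      exact ⟨p0, m0, p1, m1, p2, m2, p3, m3, by grind⟩
  · obtain ⟨c, hc, hc'⟩ := Finset.not_subset.1 e01
    exact aux_C4' P0 P1 P2 P3 h0 h1 h2 h3 c hc hc'

lemma aux_R2 (X Y A1 A2 B1 B2 : Finset ℕ) {r11 r12 r21 r22 : Prop}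
    (hX : 4 ≤ X.card) (hY : 4 ≤ Y.card) (h1 : 4 ≤ A1.card)
    (h2 : 4 ≤ A2.card)
    (h3 : 4 ≤ B1.card) (h4 : 4 ≤ B2.card) (n12 : ¬ r12) (n21 : ¬ r21) :
    AuxSol X Y A1 A2 B1 B2 r11 r12 r21 r22 := by
  obtain ⟨x, hx⟩ := Finset.card_pos.1 (show 0 < X.card by omega)
  obtain ⟨y, hy, hxy⟩ := aux_pick1 Y (by omega) x
  have key : ∀ A : Finset ℕ, 4 ≤ A.card → 2 ≤ (A \ {x, y}).card := by
    intro A hA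
    have := Finset.le_card_sdiff {x, y} A
    have := Finset.card_le_two (a := x) (b := y)
    omega
  obtain ⟨a1, ha1, a2, ha2, b2, hb2, b1, hb1, h⟩ :=
    aux_C4 _ _ _ _ (key A1 h1) (key A2 h2) (key B2 h4) (key B1 h3)
  simp only [Finset.mem_sdiff, Finset.mem_insert, Finset.mem_singleton, not_or] at ha1 ha2 hb1 hb2
  exact ⟨x, hx, y, hy, a1, ha1.1, a2, ha2.1, b1, hb1.1, b2, hb2.1, by grind⟩

lemma aux_list (X Y A1 A2 B1 B2 : Finset ℕ) {r11 r12 r21 r22 : Prop}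
    (hX : 4 ≤ X.card) (hY : 4 ≤ Y.card) (h1 : 3 ≤ A1.card) (h2 : 3 ≤ A2.card)
    (h3 : 3 ≤ B1.card) (h4 : 3 ≤ B2.card)
    (k11 : r11 → 4 ≤ A1.card ∧ 4 ≤ B1.card) (k12 : r12 → 4 ≤ A1.card ∧ 4 ≤ B2.card)
    (k21 : r21 → 4 ≤ A2.card ∧ 4 ≤ B1.card) (k22 : r22 → 4 ≤ A2.card ∧ 4 ≤ B2.card)
    (m1 : r11 → r12 → 5 ≤ A1.card) (m2 : r21 → r22 → 5 ≤ A2.card)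
    (m3 : r11 → r21 → 5 ≤ B1.card) (m4 : r12 → r22 → 5 ≤ B2.card)
    (t1 : r11 → r12 → r21 → False) (t2 : r11 → r12 → r22 → False)
    (t3 : r11 → r21 → r22 → False) (t4 : r12 → r21 → r22 → False) :
    AuxSol X Y A1 A2 B1 B2 r11 r12 r21 r22 := by
  by_cases q11 : r11
  · by_cases q22 : r22
    · exact aux_R2 _ _ _ _ _ _ hX hY (k11 q11).1 (k22 q22).1 (k11 q11).2 (k22 q22).2
        (fun h => t2 q11 h q22) (fun h => t3 q11 h q22)
    · by_cases q21 : r21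
      · exact AuxSol.swapXY (aux_R1 _ _ _ _ _ _ hY hX (k11 q11).2 (m3 q11) h4 (k11 q11).1 h2
          (fun h => t1 q11 h q21) q22)
      · exact aux_R1 _ _ _ _ _ _ hX hY (k11 q11).1 (m1 q11) h2 (k11 q11).2 h4 q21 q22
  · by_cases q12 : r12
    · by_cases q21 : r21
      · exact AuxSol.swapB (aux_R2 _ _ _ _ _ _ hX hY (k12 q12).1 (k21 q21).1 (k12 q12).2
          (k21 q21).2 q11 (fun h => t4 q12 q21 h))
      · by_cases q22 : r22
        · exact AuxSol.swapXY (AuxSol.swapA (aux_R1 _ _ _ _ _ _ hY hX (k12 q12).2 (m4 q12) h3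
            (k12 q12).1 h2 q11 q21))
        · exact AuxSol.swapB (aux_R1 _ _ _ _ _ _ hX hY (k12 q12).1 (fun h => absurd h q11) h2
            (k12 q12).2 h3 q22 q21)
    · by_cases q21 : r21
      · exact AuxSol.swapA (aux_R1 _ _ _ _ _ _ hX hY (k21 q21).1 (m2 q21) h1 (k21 q21).2 h4
          q11 q12)
      · by_cases q22 : r22
        · exact AuxSol.swapA (AuxSol.swapB (aux_R1 _ _ _ _ _ _ hX hY (k22 q22).1
            (fun h => absurd h q21) h1 (k22 q22).2 h3 q12 q11))
        · exact aux_R0 _ _ _ _ _ _ hX hY h1 h2 h3 h4 q11 q12 q21 q22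

lemma aux_J (J : Finset (Fin 4)) (h : Fin 3) :
    (J.filter (fun i => h.1 + (J.filter (· < i)).card ≤ 2)).card ≤ 3 - h.1 ∧
    min J.card (3 - h.1) ≤ (J.filter (fun i => h.1 + (J.filter (· < i)).card ≤ 2)).card := by
  revert J h
  decide

lemma aux_del {V : Type*} (G : SimpleGraph V)
    (hmin : ProperSubgraphsCh3dLE G 6) (L : V → Finset ℕ) (hL : ∀ v, 6 ≤ (L v).card)
    (S : Set V) (hS : S.Nonempty) :
    ∃ φ : V → ℕ, (∀ v, v ∉ S → φ v ∈ L v) ∧ (∀ u v, u ∉ S → v ∉ S → G.Adj u v → φ u ≠ φ v) ∧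
      ∀ v, v ∉ S → min 3 (G.neighborSet v \ S).ncard ≤ (φ '' (G.neighborSet v \ S)).ncard := by
  classical
  set H := (⊤ : G.Subgraph).deleteVerts S with hH
  have hv : ∀ v, v ∈ H.verts ↔ v ∉ S := by intro v; simp [hH]
  have hne : H ≠ ⊤ := by
    intro h
    obtain ⟨s, hs⟩ := hS
    exact (hv s).1 (by rw [h]; trivial) hs
  obtain ⟨f, ⟨hf1, hf2⟩, hf3⟩ := hmin H hne (fun v => L v) (fun v => hL v)
  have hadj : ∀ a b : H.verts, H.coe.Adj a b ↔ G.Adj a b := by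
    intro a b
    have ha := (hv a).1 a.2
    have hb := (hv b).1 b.2
    simp [hH, Subgraph.deleteVerts_adj, ha, hb]
  let φ : V → ℕ := fun v => if h : v ∈ H.verts then f ⟨v, h⟩ else 0
  have hφ : ∀ a : H.verts, φ a = f a := by intro a; simp [φ, a.2]
  have hN : ∀ a : H.verts, G.neighborSet a \ S = Subtype.val '' H.coe.neighborSet a := by
    intro a
    ext b
    simp only [Set.mem_diff, mem_neighborSet, Set.mem_image]
    constructor
    · rintro ⟨h1, h2⟩
      exact ⟨⟨b, (hv b).2 h2⟩, (hadj _ _).2 h1, rfl⟩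
    · rintro ⟨c, h1, rfl⟩
      exact ⟨(hadj _ _).1 h1, (hv c).1 c.2⟩
  refine ⟨φ, ?_, ?_, ?_⟩
  · intro v h
    rw [hφ ⟨v, (hv v).2 h⟩]
    exact hf3 _
  · intro u v hu h' h
    rw [hφ ⟨v, (hv v).2 h'⟩, hφ ⟨u, (hv u).2 hu⟩]
    exact hf1 _ _ ((hadj _ _).2 h)
  · intro v h
    have h1 := hN ⟨v, (hv v).2 h⟩
    simp only at h1
    rw [h1, Set.ncard_image_of_injective _ Subtype.val_injective, Set.image_image]
    simp only [hφ]
    exact hf2 _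

lemma aux_three (φ : V → ℕ) (p q r : V) (h1 : φ p ≠ φ q) (h2 : φ p ≠ φ r) (h3 : φ q ≠ φ r) :
    (φ '' {p, q, r}).ncard = 3 := by
  rw [Set.ncard_eq_three]
  exact ⟨φ p, φ q, φ r, h1, h2, h3, by simp [Set.image_insert_eq]⟩

lemma aux_pair (φ : V → ℕ) (p q : V) (h1 : φ p ≠ φ q) : (φ '' {p, q}).ncard = 2 := by
  rw [Set.image_pair, Set.ncard_pair h1]

lemma aux_pair' (φ : V → ℕ) (p q : V) (hpq : p ≠ q)
    (h : min 3 ({p, q} : Set V).ncard ≤ (φ '' {p, q}).ncard) : φ p ≠ φ q := by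
  intro he
  rw [Set.image_pair, he, Set.ncard_pair hpq] at h
  simp at h

lemma aux_D1 {V : Type*} [Fintype V] (G : SimpleGraph V)
    (hmin : ProperSubgraphsCh3dLE G 6) (L : V → Finset ℕ) (hL : ∀ v, 6 ≤ (L v).card)
    (u a b : V) (hu : G.neighborSet u = {a, b}) (hab : G.Adj a b)
    (ha : (G.neighborSet a).ncard ≤ 3) (hb : (G.neighborSet b).ncard ≤ 3) :
    Dyn3ListColorable G L := by
  classical
  obtain ⟨φ, h1, h2, h3⟩ := aux_del G hmin L hL {u} ⟨u, rfl⟩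
  have hua : G.Adj u a := by rw [← mem_neighborSet, hu]; simp
  have hub : G.Adj u b := by rw [← mem_neighborSet, hu]; simp
  have e1 := Set.ncard_sdiff_singleton_add_one (show u ∈ G.neighborSet a from hua.symm)
  have e2 := Set.ncard_sdiff_singleton_add_one (show u ∈ G.neighborSet b from hub.symm)
  set F : Set ℕ := φ '' (G.neighborSet a \ {u} ∪ G.neighborSet b \ {u}) with hF
  have hFc : F.ncard ≤ 4 := by
    have := Set.ncard_image_le (f := φ) (Set.toFinite (G.neighborSet a \ {u} ∪ G.neighborSet b \ {u}))
    have := Set.ncard_union_le (G.neighborSet a \ {u}) (G.neighborSet b \ {u})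
    rw [hF]
    omega
  obtain ⟨c, hc, hcF⟩ := aux_pick (L u) F.toFinset (by
    rw [← Set.ncard_eq_toFinset_card']; have := hL u; omega)
  rw [Set.mem_toFinset] at hcF
  have hcF' : ∀ w, w ≠ u → (G.Adj a w ∨ G.Adj b w) → φ w ≠ c := by
    intro w hw hh he
    apply hcF
    refine ⟨w, ?_, he⟩
    rcases hh with hh | hh
    · exact Or.inl ⟨hh, hw⟩
    · exact Or.inr ⟨hh, hw⟩
  let ψ := Function.update φ u c
  have hψu : ψ u = c := by simp [ψ]
  have hψ : ∀ w, w ≠ u → ψ w = φ w := by intro w hw; simp [ψ, hw]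
  have hua' := hua.ne
  have hub' := hub.ne
  have hnb : ∀ w, G.Adj u w → w = a ∨ w = b := by
    intro w hw
    rw [← mem_neighborSet, hu] at hw
    simpa using hw
  have hprop : ∀ w, G.Adj u w → ψ w ≠ ψ u := by
    intro w hw
    rw [hψ w hw.ne.symm, hψu]
    apply hcF' w hw.ne.symm
    rcases hnb w hw with rfl | rfl
    · exact Or.inr hab.symm
    · exact Or.inl hab
  have himg : ∀ v, ψ '' (G.neighborSet v \ {u}) = φ '' (G.neighborSet v \ {u}) := by
    intro v
    apply Set.image_congr
    intro w hw
    exact hψ w hw.2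
  refine ⟨ψ, ⟨?_, ?_⟩, ?_⟩
  · intro v w hvw
    by_cases hv : v = u
    · subst hv; exact (hprop w hvw).symm
    · by_cases hw : w = u
      · subst hw; exact hprop v hvw.symm
      · rw [hψ v hv, hψ w hw]; exact h2 v w hv hw hvw
  · intro v
    by_cases hv : v = u
    · subst hv
      rw [hu, aux_pair, Set.ncard_pair hab.ne]
      · simp
      · rw [hψ a hua'.symm, hψ b hub'.symm]
        exact h2 a b hua'.symm hub'.symm hab
    · have h4 := h3 v hv
      by_cases hvu : G.Adj u v
      · have e := Set.ncard_sdiff_singleton_add_one (show u ∈ G.neighborSet v from hvu.symm)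
        have : (φ '' (G.neighborSet v \ {u})).ncard + 1 ≤ (ψ '' G.neighborSet v).ncard := by
          rw [← himg, ← Set.ncard_insert_of_notMem (a := ψ u)]
          · apply Set.ncard_le_ncard _ (Set.toFinite _)
            rintro _ (rfl | ⟨w, hw, rfl⟩)
            · exact ⟨u, hvu.symm, rfl⟩
            · exact ⟨w, hw.1, rfl⟩
          · rintro ⟨w, hw, he⟩
            rw [hψ w hw.2, hψu] at he
            refine hcF' w hw.2 ?_ he
            rcases hnb v hvu with rfl | rfl
            · exact Or.inl hw.1
            · exact Or.inr hw.1
        omega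
      · have : G.neighborSet v \ {u} = G.neighborSet v := by
          rw [Set.sdiff_singleton_eq_self]
          intro h; exact hvu (G.adj_symm h)
        rw [← himg, this] at h4
        exact h4
  · intro v
    by_cases hv : v = u
    · subst hv; rw [hψu]; exact hc
    · rw [hψ v hv]; exact h1 v hv

lemma aux_D3 {V : Type*} [Fintype V] (G : SimpleGraph V)
    (hmin : ProperSubgraphsCh3dLE G 6) (L : V → Finset ℕ) (hL : ∀ v, 6 ≤ (L v).card)
    (x y x1 x2 y1 y2 : V) (hx : G.neighborSet x = {y, x1, x2}) (hy : G.neighborSet y = {x, y1, y2})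
    (hx1 : G.neighborSet x1 = {x, y1}) (hy1 : G.neighborSet y1 = {y, x1})
    (n1 : x1 ≠ x2) (n2 : y1 ≠ y2) (n3 : x2 ≠ y) (n4 : y2 ≠ x) (n5 : x2 ≠ y1) (n6 : y2 ≠ x1) :
    Dyn3ListColorable G L := by
  classical
  obtain ⟨φ, h1, h2, h3⟩ := aux_del G hmin L hL {x1, y1} ⟨x1, by simp⟩
  have ax : ∀ w, G.Adj x w ↔ w = y ∨ w = x1 ∨ w = x2 := by
    intro w; rw [← mem_neighborSet, hx]; simp
  have ay : ∀ w, G.Adj y w ↔ w = x ∨ w = y1 ∨ w = y2 := by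
    intro w; rw [← mem_neighborSet, hy]; simp
  have ax1 : ∀ w, G.Adj x1 w ↔ w = x ∨ w = y1 := by
    intro w; rw [← mem_neighborSet, hx1]; simp
  have ay1 : ∀ w, G.Adj y1 w ↔ w = y ∨ w = x1 := by
    intro w; rw [← mem_neighborSet, hy1]; simp
  have d1 : x ≠ y := ((ax y).2 (by simp)).ne
  have d2 : x ≠ x1 := ((ax x1).2 (by simp)).ne
  have d3 : y ≠ y1 := ((ay y1).2 (by simp)).ne
  have d4 : x1 ≠ y1 := ((ax1 y1).2 (by simp)).ne
  have d5 : x ≠ x2 := ((ax x2).2 (by simp)).ne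
  have d6 : y ≠ y2 := ((ay y2).2 (by simp)).ne
  have d7 : x ≠ y1 := by
    rintro rfl
    have := (ax x2).2 (by simp)
    rw [ay1] at this
    grind
  have d8 : y ≠ x1 := by
    rintro rfl
    have := (ay y2).2 (by simp)
    rw [ax1] at this
    grind
  have f1 : φ x ≠ φ y := h2 x y (by simp [d2, d7]) (by simp [d3, d8]) ((ax y).2 (by simp))
  have f2 : φ y ≠ φ x2 := by
    have e : G.neighborSet x \ {x1, y1} = {y, x2} := by
      rw [hx]; ext w; simp; grind
    have := h3 x (by simp [d2, d7])
    rw [e] at this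
    exact aux_pair' φ _ _ n3.symm this
  have f3 : φ x ≠ φ y2 := by
    have e : G.neighborSet y \ {x1, y1} = {x, y2} := by
      rw [hy]; ext w; simp; grind
    have := h3 y (by simp [d3, d8])
    rw [e] at this
    exact aux_pair' φ _ _ n4.symm this
  obtain ⟨c, hc, hc'⟩ := aux_pick3 (L x1) (by have := hL x1; omega) (φ x) (φ y) (φ x2)
  obtain ⟨d, hd, hd'⟩ := aux_pick4 (L y1) (by have := hL y1; omega) (φ x) (φ y) (φ y2) c
  obtain ⟨ψ, p1, p2, p3⟩ : ∃ ψ : V → ℕ, ψ x1 = c ∧ ψ y1 = d ∧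
      ∀ w, w ∉ ({x1, y1} : Set V) → ψ w = φ w := by
    refine ⟨Function.update (Function.update φ x1 c) y1 d, by simp [d4], by simp, ?_⟩
    intro w hw
    simp at hw
    simp [hw]
  have q1 := p3 x (by simp [d2, d7])
  have q2 := p3 y (by simp [d3, d8])
  have q3 := p3 x2 (by simp [n1.symm, n5])
  have q4 := p3 y2 (by simp [n2.symm, n6])
  have hprop : ∀ s, s ∈ ({x1, y1} : Set V) → ∀ w, G.Adj s w → ψ s ≠ ψ w := by
    rintro s (rfl | rfl) w hw
    · rcases (ax1 w).1 hw with rfl | rfl <;> grind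
    · rcases (ay1 w).1 hw with rfl | rfl <;> grind
  refine ⟨ψ, ⟨?_, ?_⟩, ?_⟩
  · intro v w hvw
    by_cases hv : v ∈ ({x1, y1} : Set V)
    · exact hprop v hv w hvw
    · by_cases hw : w ∈ ({x1, y1} : Set V)
      · exact (hprop w hw v hvw.symm).symm
      · rw [p3 v hv, p3 w hw]; exact h2 v w hv hw hvw
  · intro v
    by_cases v1 : v = x
    · subst v1
      rw [hx, aux_three]
      · simp
      all_goals grind
    by_cases v2 : v = y
    · subst v2
      rw [hy, aux_three]
      · simp
      all_goals grind
    by_cases v3 : v = x1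
    · subst v3
      rw [hx1, aux_pair, Set.ncard_pair d7]
      · simp
      all_goals grind
    by_cases v4 : v = y1
    · subst v4
      rw [hy1, aux_pair, Set.ncard_pair d8]
      · simp
      all_goals grind
    have e : ∀ w ∈ G.neighborSet v, w ∉ ({x1, y1} : Set V) := by
      rintro w hw (rfl | rfl)
      · have := (ax1 v).1 (G.adj_symm hw); grind
      · have := (ay1 v).1 (G.adj_symm hw); grind
    have e1 : G.neighborSet v \ {x1, y1} = G.neighborSet v := by
      ext w; constructor
      · exact fun h => h.1
      · exact fun h => ⟨h, e w h⟩
    have := h3 v (by simp [v3, v4])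
    rw [e1] at this
    rwa [Set.image_congr (fun w hw => p3 w (e w hw))]
  · intro v
    by_cases v3 : v = x1
    · subst v3; rwa [p1]
    by_cases v4 : v = y1
    · subst v4; rwa [p2]
    rw [p3 v (by simp [v3, v4])]
    exact h1 v (by simp [v3, v4])

set_option maxHeartbeats 1000000 in
lemma aux_main {V : Type*} [Fintype V] (G : SimpleGraph V)
    (hmin : ProperSubgraphsCh3dLE G 6) (L : V → Finset ℕ) (hL : ∀ v, 6 ≤ (L v).card)
    (x y : V) (s c p : Fin 4 → V) (hs : Function.Injective s)
    (hx : G.neighborSet x = {y, s 0, s 1}) (hy : G.neighborSet y = {x, s 2, s 3})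
    (hsx : ∀ i, s i ≠ x) (hsy : ∀ i, s i ≠ y)
    (hp0 : p 0 = x) (hp1 : p 1 = x) (hp2 : p 2 = y) (hp3 : p 3 = y)
    (hN : ∀ i, G.neighborSet (s i) = {p i, c i})
    (hcx : ∀ i, c i ≠ x) (hcy : ∀ i, c i ≠ y) (hcs : ∀ i j, c i ≠ s j) :
    Dyn3ListColorable G L := by
  classical
  set S : Set V := {v | v = x ∨ v = y ∨ ∃ i, s i = v} with hS
  have hpS : ∀ i, p i = x ∨ p i = y := by
    intro i; fin_cases i
    · exact Or.inl hp0
    · exact Or.inl hp1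
    · exact Or.inr hp2
    · exact Or.inr hp3
  have hcS : ∀ i, c i ∉ S := by
    intro i h
    rcases h with h | h | ⟨j, h⟩
    · exact hcx i h
    · exact hcy i h
    · exact hcs i j h.symm
  have hxy : x ≠ y := by
    have : G.Adj x y := by rw [← mem_neighborSet, hx]; simp
    exact this.ne
  obtain ⟨φ, h1, h2, h3⟩ := aux_del G hmin L hL S ⟨x, Or.inl rfl⟩
  let N : V → Set V := fun v => G.neighborSet v \ S
  let hh : V → ℕ := fun v => (N v).ncard
  let J : V → Finset (Fin 4) := fun v => Finset.univ.filter (fun i => c i = v)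
  let T : V → Finset (Fin 4) := fun v =>
    (J v).filter (fun i => hh v + ((J v).filter (· < i)).card ≤ 2)
  have hT1 : ∀ v i, i ∈ T v → c i = v ∧ hh v ≤ 2 := by
    intro v i hi
    simp only [T, J, Finset.mem_filter, Finset.mem_univ, true_and] at hi
    exact ⟨hi.1, by omega⟩
  have hT2 : ∀ v, hh v ≤ 2 → (T v).card ≤ 3 - hh v ∧ min (J v).card (3 - hh v) ≤ (T v).card :=
    fun v hv => aux_J (J v) ⟨hh v, by omega⟩
  let E : Fin 4 → Finset ℕ := fun i => if i ∈ T (c i) then (φ '' (N (c i))).toFinset else ∅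
  let F : Fin 4 → Finset ℕ := fun i => L (s i) \ insert (φ (c i)) (E i)
  have hF1 : ∀ i, 5 - (E i).card ≤ (F i).card := by
    intro i
    have h4 := Finset.le_card_sdiff (insert (φ (c i)) (E i)) (L (s i))
    have h5 := Finset.card_insert_le (φ (c i)) (E i)
    have h6 := hL (s i)
    simp only [F]
    omega
  have hE1 : ∀ i, i ∈ T (c i) → (E i).card ≤ hh (c i) := by
    intro i hi
    simp only [E, if_pos hi]
    rw [← Set.ncard_eq_toFinset_card']
    exact Set.ncard_image_le (Set.toFinite _)
  have hF3 : ∀ i, 3 ≤ (F i).card := by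
    intro i
    have h4 := hF1 i
    by_cases hi : i ∈ T (c i)
    · have := hE1 i hi
      have := (hT1 _ _ hi).2
      omega
    · have : (E i).card = 0 := by simp [E, if_neg hi]
      omega
  let r : Fin 4 → Fin 4 → Prop := fun i j => c i = c j ∧ i ∈ T (c i) ∧ j ∈ T (c i)
  have rsymm : ∀ i j, r i j → r j i := by
    rintro i j ⟨e, a, b⟩
    exact ⟨e.symm, e ▸ b, e ▸ a⟩
  have K : ∀ i, ∀ Q : Finset (Fin 4), i ∈ Q → (∀ j ∈ Q, j ∈ T (c i)) →
      2 + Q.card ≤ (F i).card ∧ Q.card ≤ 3 := by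
    intro i Q hi hQ
    have a1 := Finset.card_le_card (show Q ⊆ T (c i) from hQ)
    have a2 := hT1 _ _ (hQ i hi)
    have a3 := (hT2 _ a2.2).1
    have a4 := hE1 i (hQ i hi)
    have a5 := hF1 i
    omega
  have K2 : ∀ i j, i ≠ j → r i j → 4 ≤ (F i).card := by
    rintro i j hij ⟨e, a, b⟩
    have := (K i {i, j} (by simp) (by simp [a, b])).1
    rw [Finset.card_pair hij] at this
    omega
  have K3 : ∀ i j k, i ≠ j → i ≠ k → j ≠ k → r i j → r i k → 5 ≤ (F i).card := by
    rintro i j k hij hik hjk ⟨e, a, b⟩ ⟨_, _, b'⟩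
    have := (K i {i, j, k} (by simp) (by simp [a, b, b'])).1
    rw [Finset.card_eq_three.2 ⟨i, j, k, hij, hik, hjk, rfl⟩] at this
    omega
  have K4 : ∀ v, 0 ∈ T v → 1 ∈ T v → 2 ∈ T v → 3 ∈ T v → False := by
    intro v a b d e
    have hc0 := (hT1 _ _ a).1
    have := (K 0 Finset.univ (by simp) (by
      intro j _; rw [hc0]; fin_cases j <;> assumption)).2
    simp at this
  have rtrans : ∀ i j k, r i j → r j k → r i k := by
    rintro i j k ⟨e, a, b⟩ ⟨e', a', b'⟩
    exact ⟨e.trans e', a, e ▸ b'⟩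
  have K5 : r 0 1 → r 0 2 → r 0 3 → False :=
    fun h1 h2 h3 => K4 (c 0) h1.2.1 h1.2.2 h2.2.2 h3.2.2
  have hrI : ∀ i j, c i = c j → i ∈ T (c i) → j ∈ T (c i) → r i j := fun i j a b d => ⟨a, b, d⟩
  clear_value r
  let X : Finset ℕ := L x \ {φ (c 0), φ (c 1)}
  let Y : Finset ℕ := L y \ {φ (c 2), φ (c 3)}
  have hXc : 4 ≤ X.card := by
    have h4 := Finset.le_card_sdiff {φ (c 0), φ (c 1)} (L x)
    have h5 := Finset.card_le_two (a := φ (c 0)) (b := φ (c 1))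
    have h6 := hL x
    simp only [X]
    omega
  have hYc : 4 ≤ Y.card := by
    have h4 := Finset.le_card_sdiff {φ (c 2), φ (c 3)} (L y)
    have h5 := Finset.card_le_two (a := φ (c 2)) (b := φ (c 3))
    have h6 := hL y
    simp only [Y]
    omega
  have sol : AuxSol X Y (F 0) (F 1) (F 2) (F 3) (r 0 2) (r 0 3) (r 1 2) (r 1 3) := by
    apply aux_list X Y _ _ _ _ hXc hYc (hF3 0) (hF3 1) (hF3 2) (hF3 3)
    · exact fun h => ⟨K2 _ _ (by decide) h, K2 _ _ (by decide) (rsymm _ _ h)⟩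
    · exact fun h => ⟨K2 _ _ (by decide) h, K2 _ _ (by decide) (rsymm _ _ h)⟩
    · exact fun h => ⟨K2 _ _ (by decide) h, K2 _ _ (by decide) (rsymm _ _ h)⟩
    · exact fun h => ⟨K2 _ _ (by decide) h, K2 _ _ (by decide) (rsymm _ _ h)⟩
    · exact fun h h' => K3 _ _ _ (by decide) (by decide) (by decide) h h'
    · exact fun h h' => K3 _ _ _ (by decide) (by decide) (by decide) h h'
    · exact fun h h' => K3 _ _ _ (by decide) (by decide) (by decide) (rsymm _ _ h) (rsymm _ _ h')
    · exact fun h h' => K3 _ _ _ (by decide) (by decide) (by decide) (rsymm _ _ h) (rsymm _ _ h')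
    · exact fun h1 h2 h3 => K5 (rtrans _ _ _ h1 (rsymm _ _ h3)) h1 h2
    · exact fun h1 h2 h3 => K5 (rtrans _ _ _ h2 (rsymm _ _ h3)) h1 h2
    · exact fun h1 h2 h3 => K5 (rtrans _ _ _ h1 (rsymm _ _ h2)) h1
        (rtrans _ _ _ (rtrans _ _ _ h1 (rsymm _ _ h2)) h3)
    · exact fun h1 h2 h3 => K5 (rtrans _ _ _ h1 (rsymm _ _ h3))
        (rtrans _ _ _ (rtrans _ _ _ h1 (rsymm _ _ h3)) h2) h1
  obtain ⟨cx, hcx', cy, hcy', a1, ha1, a2, ha2, b1, hb1, b2, hb2, nxy, n1, n2, n3, n4, n5, n6,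
    n7, n8, n9, n10⟩ := sol
  obtain ⟨ψ, px, py, p0, p1, p2, p3, pS⟩ : ∃ ψ : V → ℕ, ψ x = cx ∧ ψ y = cy ∧ ψ (s 0) = a1 ∧
      ψ (s 1) = a2 ∧ ψ (s 2) = b1 ∧ ψ (s 3) = b2 ∧ ∀ v, v ∉ S → ψ v = φ v := by
    refine ⟨Function.update (Function.update (Function.extend s ![a1, a2, b1, b2] φ) x cx) y cy,
      by simp [hxy], by simp, ?_, ?_, ?_, ?_, ?_⟩
    · simp [hsx, hsy, hs.extend_apply]
    · simp [hsx, hsy, hs.extend_apply]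
    · simp [hsx, hsy, hs.extend_apply]
    · simp [hsx, hsy, hs.extend_apply]
    · intro v hv
      simp only [hS, Set.mem_setOf_eq, not_or] at hv
      simp [hv.1, hv.2.1, Function.extend_apply' _ _ _ hv.2.2]
  have hψF : ∀ i, ψ (s i) ∈ F i := by
    intro i; fin_cases i
    · exact p0 ▸ ha1
    · exact p1 ▸ ha2
    · exact p2 ▸ hb1
    · exact p3 ▸ hb2
  have hψx : ψ x ∈ X := px ▸ hcx'
  have hψy : ψ y ∈ Y := py ▸ hcy'
  have hψF1 : ∀ i, ψ (s i) ∈ L (s i) ∧ ψ (s i) ≠ φ (c i) ∧ ψ (s i) ∉ E i := by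
    intro i
    have := hψF i
    simp only [F, Finset.mem_sdiff, Finset.mem_insert, not_or] at this
    exact this
  simp only [X, Y, Finset.mem_sdiff, Finset.mem_insert, Finset.mem_singleton, not_or] at hψx hψy
  have hpc : ∀ i, ψ (p i) ≠ φ (c i) := by
    intro i; fin_cases i
    · simpa [hp0] using hψx.2.1
    · simpa [hp1] using hψx.2.2
    · simpa [hp2] using hψy.2.1
    · simpa [hp3] using hψy.2.2
  have hxs : ∀ i, ψ (s i) ≠ ψ x ∧ ψ (s i) ≠ ψ y := by
    intro i; fin_cases i
    · simp only [px, py]; exact p0 ▸ n1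
    · simp only [px, py]; exact p1 ▸ n2
    · simp only [px, py]; exact p2 ▸ n3
    · simp only [px, py]; exact p3 ▸ n4
  have hinj : ∀ v, Set.InjOn (ψ ∘ s) (T v : Set (Fin 4)) := by
    have key : ∀ v, ∀ i ∈ T v, ∀ j ∈ T v, i < j → ψ (s i) ≠ ψ (s j) := by
      intro v i hi j hj hij
      have hr : r i j := by
        have e1 := (hT1 _ _ hi).1
        have e2 := (hT1 _ _ hj).1
        exact hrI _ _ (by rw [e1, e2]) (by rwa [e1]) (by rwa [e1])
      fin_cases i <;> fin_cases j <;> first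
        | exact absurd hij (by decide)
        | (simp only [Fin.zero_eta, Fin.mk_one, Fin.reduceFinMk] at hr ⊢; grind)
    intro v i hi j hj hij
    by_contra hne
    rcases lt_or_gt_of_ne hne with h | h
    · exact key v i hi j hj h hij
    · exact key v j hj i hi h hij.symm
  have as : ∀ i w, G.Adj (s i) w ↔ w = p i ∨ w = c i := by
    intro i w; rw [← mem_neighborSet, hN]; simp
  have hprop : ∀ u, u ∈ S → ∀ w, G.Adj u w → ψ u ≠ ψ w := by
    rintro u (rfl | rfl | ⟨i, rfl⟩) w hw
    · rw [← mem_neighborSet, hx] at hw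
      rcases hw with rfl | rfl | rfl
      · rw [px, py]; exact nxy
      · exact (hxs _).1.symm
      · exact (hxs _).1.symm
    · rw [← mem_neighborSet, hy] at hw
      rcases hw with rfl | rfl | rfl
      · rw [px, py]; exact nxy.symm
      · exact (hxs _).2.symm
      · exact (hxs _).2.symm
    · rcases (as i w).1 hw with rfl | rfl
      · rcases hpS i with h | h
        · rw [h]; exact (hxs i).1
        · rw [h]; exact (hxs i).2
      · rw [pS _ (hcS i)]; exact (hψF1 i).2.1
  refine ⟨ψ, ⟨?_, ?_⟩, ?_⟩
  · intro v w hvw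
    by_cases hv : v ∈ S
    · exact hprop v hv w hvw
    · by_cases hw : w ∈ S
      · exact (hprop w hw v hvw.symm).symm
      · rw [pS v hv, pS w hw]; exact h2 v w hv hw hvw
  · intro v
    by_cases hv : v ∈ S
    · rcases hv with rfl | rfl | ⟨i, rfl⟩
      · rw [hx, aux_three]
        · simp
        · exact (hxs _).2.symm
        · exact (hxs _).2.symm
        · rw [p0, p1]; exact n5
      · rw [hy, aux_three]
        · simp
        · exact (hxs _).1.symm
        · exact (hxs _).1.symm
        · rw [p2, p3]; exact n6
      · have e : p i ≠ c i := by
          rcases hpS i with h | h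
          · rw [h]; exact (hcx i).symm
          · rw [h]; exact (hcy i).symm
        rw [hN, aux_pair, Set.ncard_pair e]
        · simp
        · rw [pS _ (hcS i)]; exact hpc i
    · have h4 : min 3 (hh v) ≤ (φ '' N v).ncard := h3 v hv
      have himg : ψ '' N v = φ '' N v := Set.image_congr (fun w hw => pS w hw.2)
      have hsub : φ '' N v ⊆ ψ '' G.neighborSet v := by
        rw [← himg]; exact Set.image_mono (fun w hw => hw.1)
      by_cases h5 : hh v ≤ 2
      · have hJ : ∀ i, i ∈ J v ↔ c i = v := by intro i; simp [J]
        have hNv : G.neighborSet v ⊆ N v ∪ s '' (J v : Set (Fin 4)) := by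
          intro w hw
          by_cases hwS : w ∈ S
          · right
            rcases hwS with rfl | rfl | ⟨i, rfl⟩
            · exfalso; apply hv
              have : v ∈ G.neighborSet w := G.adj_symm hw
              rw [hx] at this
              rcases this with rfl | rfl | rfl
              · exact Or.inr (Or.inl rfl)
              · exact Or.inr (Or.inr ⟨_, rfl⟩)
              · exact Or.inr (Or.inr ⟨_, rfl⟩)
            · exfalso; apply hv
              have : v ∈ G.neighborSet w := G.adj_symm hw
              rw [hy] at this
              rcases this with rfl | rfl | rfl
              · exact Or.inl rfl
              · exact Or.inr (Or.inr ⟨_, rfl⟩)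
              · exact Or.inr (Or.inr ⟨_, rfl⟩)
            · refine ⟨i, ?_, rfl⟩
              rcases (as i v).1 (G.adj_symm hw) with h | h
              · exfalso; apply hv
                rcases hpS i with h' | h'
                · exact Or.inl (h.trans h')
                · exact Or.inr (Or.inl (h.trans h'))
              · exact (hJ i).2 h.symm
          · exact Or.inl ⟨hw, hwS⟩
        have g1 := Set.ncard_le_ncard hNv (Set.toFinite _)
        have g2 := Set.ncard_union_le (N v) (s '' (J v : Set (Fin 4)))
        have g3 := Set.ncard_image_le (f := s) (Set.toFinite (J v : Set (Fin 4)))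
        rw [Set.ncard_coe_finset] at g3
        have g4 := (hT2 v h5).2
        have g5 := Set.ncard_image_of_injOn (hinj v)
        rw [Set.ncard_coe_finset] at g5
        have g6 : Disjoint (φ '' N v) ((ψ ∘ s) '' (T v : Set (Fin 4))) := by
          rw [Set.disjoint_right]
          rintro _ ⟨i, hi, rfl⟩ hm
          have e1 := (hT1 v i hi).1
          subst e1
          apply (hψF1 i).2.2
          have hi' : i ∈ T (c i) := hi
          simp only [E, if_pos hi', Set.mem_toFinset]
          exact hm
        have g7 := Set.ncard_union_eq g6 (Set.toFinite _) (Set.toFinite _)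
        have g8 : φ '' N v ∪ (ψ ∘ s) '' (T v : Set (Fin 4)) ⊆ ψ '' G.neighborSet v := by
          apply Set.union_subset hsub
          rintro _ ⟨i, hi, rfl⟩
          refine ⟨s i, ?_, rfl⟩
          have e1 := (hT1 v i hi).1
          exact G.adj_symm ((as i v).2 (Or.inr e1.symm))
        have g9 := Set.ncard_le_ncard g8 (Set.toFinite _)
        have g10 : hh v = (N v).ncard := rfl
        omega
      · have := Set.ncard_le_ncard hsub (Set.toFinite _)
        omega
  · intro v
    by_cases hv : v ∈ S
    · rcases hv with rfl | rfl | ⟨i, rfl⟩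
      · exact hψx.1
      · exact hψy.1
      · exact (hψF1 i).1
    · rw [pS v hv]; exact h1 v hv

lemma aux_W2 {V : Type*} [Fintype V] (G : SimpleGraph V) (x y : V) (hx : Wmem G 2 x)
    (hy : Wmem G 2 y) (h : G.Adj x y) :
    ∃ x1 x2, x1 ≠ x2 ∧ x1 ≠ y ∧ x2 ≠ y ∧ G.neighborSet x = {y, x1, x2} ∧
      (∃ u, u ≠ x ∧ G.neighborSet x1 = {x, u}) ∧ ∃ u, u ≠ x ∧ G.neighborSet x2 = {x, u} := by
  obtain ⟨h1, h2⟩ := hx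
  obtain ⟨x1, x2, hne, he⟩ := Set.ncard_eq_two.1 h2
  have m1 : G.Adj x x1 ∧ (G.neighborSet x1).ncard = 2 := by
    have : x1 ∈ ({x1, x2} : Set V) := by simp
    rw [← he] at this; exact this
  have m2 : G.Adj x x2 ∧ (G.neighborSet x2).ncard = 2 := by
    have : x2 ∈ ({x1, x2} : Set V) := by simp
    rw [← he] at this; exact this
  have n1 : x1 ≠ y := by rintro rfl; have := hy.1; omega
  have n2 : x2 ≠ y := by rintro rfl; have := hy.1; omega
  have key : ∀ z, G.Adj x z → (G.neighborSet z).ncard = 2 →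
      ∃ u, u ≠ x ∧ G.neighborSet z = {x, u} := by
    intro z hz hc
    obtain ⟨p, q, hpq, e⟩ := Set.ncard_eq_two.1 hc
    have : x ∈ G.neighborSet z := hz.symm
    rw [e] at this
    rcases this with rfl | rfl
    · exact ⟨q, hpq.symm, e⟩
    · exact ⟨p, hpq, by rw [e, Set.pair_comm]⟩
  refine ⟨x1, x2, hne, n1, n2, ?_, key _ m1.1 m1.2, key _ m2.1 m2.2⟩
  symm
  apply Set.eq_of_subset_of_ncard_le _ _ (Set.toFinite _)
  · rintro w (rfl | rfl | rfl)
    · exact h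
    · exact m1.1
    · exact m2.1
  · rw [h1, Set.ncard_eq_three.2 ⟨y, x1, x2, n1.symm, n2.symm, hne, rfl⟩]

theorem min_counterexample_no_adjacent_W2 {V : Type*} [Fintype V]
    (G : SimpleGraph V) (hmad : MadLT G (18 / 7)) (hG : ¬ Ch3dLE G 6)
    (hmin : ProperSubgraphsCh3dLE G 6) :
    ∀ x y : V, Wmem G 2 x → Wmem G 2 y → ¬ G.Adj x y := by
  intro x y hx hy hxy
  apply hG
  intro L hL
  obtain ⟨x1, x2, nx, nx1, nx2, Nx, ⟨u1, hu1, Nx1⟩, ⟨u2, hu2, Nx2⟩⟩ := aux_W2 G x y hx hy hxy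
  obtain ⟨y1, y2, ny, ny1, ny2, Ny, ⟨w1, hw1, Ny1⟩, ⟨w2, hw2, Ny2⟩⟩ := aux_W2 G y x hy hx hxy.symm
  have ax : ∀ w, G.Adj x w ↔ w = y ∨ w = x1 ∨ w = x2 := by
    intro w; rw [← mem_neighborSet, Nx]; simp
  have ay : ∀ w, G.Adj y w ↔ w = x ∨ w = y1 ∨ w = y2 := by
    intro w; rw [← mem_neighborSet, Ny]; simp
  have ax1 : ∀ w, G.Adj x1 w ↔ w = x ∨ w = u1 := by
    intro w; rw [← mem_neighborSet, Nx1]; simp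
  have ax2 : ∀ w, G.Adj x2 w ↔ w = x ∨ w = u2 := by
    intro w; rw [← mem_neighborSet, Nx2]; simp
  have ay1 : ∀ w, G.Adj y1 w ↔ w = y ∨ w = w1 := by
    intro w; rw [← mem_neighborSet, Ny1]; simp
  have ay2 : ∀ w, G.Adj y2 w ↔ w = y ∨ w = w2 := by
    intro w; rw [← mem_neighborSet, Ny2]; simp
  have cx : (G.neighborSet x).ncard ≤ 3 := hx.1.le
  have cy : (G.neighborSet y).ncard ≤ 3 := hy.1.le
  have cx2 : (G.neighborSet x2).ncard ≤ 3 := by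
    rw [Nx2, Set.ncard_pair hu2.symm]; omega
  have cy2 : (G.neighborSet y2).ncard ≤ 3 := by
    rw [Ny2, Set.ncard_pair hw2.symm]; omega
  by_cases t1 : u1 = y
  · exact aux_D1 G hmin L hL x1 x y (t1 ▸ Nx1) hxy cx cy
  by_cases t2 : u2 = y
  · exact aux_D1 G hmin L hL x2 x y (t2 ▸ Nx2) hxy cx cy
  by_cases t3 : u1 = x2
  · exact aux_D1 G hmin L hL x1 x x2 (t3 ▸ Nx1) ((ax x2).2 (by simp)) cx cx2
  by_cases t4 : w1 = y2
  · exact aux_D1 G hmin L hL y1 y y2 (t4 ▸ Ny1) ((ay y2).2 (by simp)) cy cy2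
  have sx1 : x ≠ x1 := ((ax x1).2 (by simp)).ne
  have sx2 : x ≠ x2 := ((ax x2).2 (by simp)).ne
  have sy1 : y ≠ y1 := ((ay y1).2 (by simp)).ne
  have sy2 : y ≠ y2 := ((ay y2).2 (by simp)).ne
  have sxy : x ≠ y := hxy.ne
  have z1 : ¬ G.Adj x1 y := by rw [ax1]; grind
  have z2 : ¬ G.Adj x2 y := by rw [ax2]; grind
  have o11 : x1 ≠ y1 := by rintro rfl; exact z1 (G.adj_symm ((ay _).2 (by simp)))
  have o12 : x1 ≠ y2 := by rintro rfl; exact z1 (G.adj_symm ((ay _).2 (by simp)))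
  have o21 : x2 ≠ y1 := by rintro rfl; exact z2 (G.adj_symm ((ay _).2 (by simp)))
  have o22 : x2 ≠ y2 := by rintro rfl; exact z2 (G.adj_symm ((ay _).2 (by simp)))
  have D : ∀ a b a' b' p q : V, G.neighborSet x = {y, a, b} → G.neighborSet y = {x, a', b'} →
      G.neighborSet a = {x, p} → G.neighborSet a' = {y, q} → x ≠ a' → a ≠ b → a' ≠ b' → b ≠ y →
      b' ≠ x → b ≠ a' → b' ≠ a → a ≠ y → p = a' → Dyn3ListColorable G L := by
    intro a b a' b' p q e1 e2 e3 e4 s0 s1 s2 s3 s4 s5 s6 s7 hp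
    have hq : q = a := by
      have : G.Adj a a' := by rw [← mem_neighborSet, e3, hp]; simp
      have h' : a ∈ G.neighborSet a' := G.adj_symm this
      rw [e4] at h'
      rcases h' with h' | h'
      · exact absurd h' s7
      · exact h'.symm
    subst hp hq
    exact aux_D3 G hmin L hL x y _ b _ b' e1 e2 e3 e4 s1 s2 s3 s4 s5 s6
  have Nx' : G.neighborSet x = {y, x2, x1} := by rw [Nx, Set.pair_comm x1 x2]
  have Ny' : G.neighborSet y = {x, y2, y1} := by rw [Ny, Set.pair_comm y1 y2]
  by_cases q11 : u1 = y1
  · exact D x1 x2 y1 y2 u1 w1 Nx Ny Nx1 Ny1 ny1.symm nx ny nx2 ny2 o21 o12.symm nx1 q11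
  by_cases q12 : u1 = y2
  · exact D x1 x2 y2 y1 u1 w2 Nx Ny' Nx1 Ny2 ny2.symm nx ny.symm nx2 ny1 o22 o11.symm nx1 q12
  by_cases q21 : u2 = y1
  · exact D x2 x1 y1 y2 u2 w1 Nx' Ny Nx2 Ny1 ny1.symm nx.symm ny nx1 ny2 o11 o22.symm nx2 q21
  by_cases q22 : u2 = y2
  · exact D x2 x1 y2 y1 u2 w2 Nx' Ny' Nx2 Ny2 ny2.symm nx.symm ny.symm nx1 ny1 o12 o21.symm nx2 q22
  have l1 : u1 ≠ x1 := ((ax1 u1).2 (by simp)).ne.symm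
  have l2 : u2 ≠ x2 := ((ax2 u2).2 (by simp)).ne.symm
  have l3 : w1 ≠ y1 := ((ay1 w1).2 (by simp)).ne.symm
  have l4 : w2 ≠ y2 := ((ay2 w2).2 (by simp)).ne.symm
  have b1 := ax1 x2
  have b2 := ax1 y1
  have b3 := ax1 y2
  have b4 := ax2 x1
  have b5 := ax2 y1
  have b6 := ax2 y2
  have c1 := ay1 x1
  have c2 := ay1 x2
  have c3 := ay1 y2
  have c4 := ay2 x1
  have c5 := ay2 x2
  have c6 := ay2 y1
  have m1 := G.adj_comm x1 x2
  have m2 := G.adj_comm x1 y1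
  have m3 := G.adj_comm x1 y2
  have m4 := G.adj_comm x2 y1
  have m5 := G.adj_comm x2 y2
  have m6 := G.adj_comm y1 y2
  have i1 : w1 ≠ x := by
    rintro rfl
    have := (ay1 w1).2 (by simp)
    have := (ax y1).1 this.symm
    grind
  have i2 : w2 ≠ x := by
    rintro rfl
    have := (ay2 w2).2 (by simp)
    have := (ax y2).1 this.symm
    grind
  refine aux_main G hmin L hL x y ![x1, x2, y1, y2] ![u1, u2, w1, w2] ![x, x, y, y] ?_ Nx Ny
    ?_ ?_ rfl rfl rfl rfl ?_ ?_ ?_ ?_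
  · intro i j hij
    fin_cases i <;> fin_cases j <;> simp at hij ⊢ <;> grind
  · intro i; fin_cases i <;> simp <;> grind
  · intro i; fin_cases i <;> simp <;> grind
  · intro i; fin_cases i <;> simp <;> assumption
  · intro i; fin_cases i <;> simp <;> grind
  · intro i; fin_cases i <;> simp <;> grind
  · intro i j; fin_cases i <;> fin_cases j <;> simp <;> grind
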